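/- Let a > 0 and c > 0, and define φ(x) = exp( −c / log(1 + a·x) ) for x > 0. Then φ is twice differentiable on (0,∞), and for every x > 0 one has φ″(x) < 0 if and only if log(1 + a·x) > √(1 + c) − 1. -/

import Mathlib

/-- Concavity threshold of `ς(x) = exp(-c / log(1 + a x))` (the integrand of the
Laplace–Stieltjes transform of the service time): for `a, c > 0`, the function is twice
differentiable on `(0, ∞)` and its second derivative is negative exactly where
`log(1 + a x) > √(1 + c) - 1`. -/
theorem varsigma_concavity_threshold
    (a c : ℝ) (ha : 0 < a) (hc : 0 < c)
    (φ : ℝ → ℝ) (hφ : ∀ x, φ x = Real.exp (-c / Real.log (1 + a * x))) :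
    (∀ x ∈ Set.Ioi (0 : ℝ), DifferentiableAt ℝ φ x ∧ DifferentiableAt ℝ (deriv φ) x) ∧
      ∀ x > (0 : ℝ),
        (deriv (deriv φ) x < 0 ↔ Real.sqrt (1 + c) - 1 < Real.log (1 + a * x)) := by
  have hu : ∀ x : ℝ, 0 < x → 1 < 1 + a * x := fun x hx => by
    have := mul_pos ha hx
    linarith
  have hL : ∀ x : ℝ, 0 < x → 0 < Real.log (1 + a * x) := fun x hx => Real.log_pos (hu x hx)
  have hφe : φ = fun x => Real.exp (-c / Real.log (1 + a * x)) := funext hφ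
  have hdu : ∀ x : ℝ, HasDerivAt (fun y : ℝ => 1 + a * y) a x := fun x => by
    simpa using ((hasDerivAt_id x).const_mul a).const_add 1
  have hdL : ∀ x : ℝ, 0 < x →
      HasDerivAt (fun y : ℝ => Real.log (1 + a * y)) (a / (1 + a * x)) x := fun x hx =>
    (hdu x).log (by have := hu x hx; linarith)
  have h1 : ∀ x : ℝ, 0 < x → HasDerivAt φ
      (φ x * (c * a / ((1 + a * x) * Real.log (1 + a * x) ^ 2))) x := by
    intro x hx
    have hLx := (hL x hx).ne'
    have hux : 1 + a * x ≠ 0 := by have := hu x hx; linarith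
    have h := (((hasDerivAt_const x (-c)).fun_div (hdL x hx) hLx)).exp
    rw [hφe]
    refine h.congr_deriv ?_
    field_simp
    ring
  have h2 : ∀ x : ℝ, 0 < x → HasDerivAt (deriv φ)
      (φ x * (c * a ^ 2 / ((1 + a * x) ^ 2 * Real.log (1 + a * x) ^ 4)) *
        (c + 1 - (Real.log (1 + a * x) + 1) ^ 2)) x := by
    intro x hx
    have hLx := (hL x hx).ne'
    have hux : 1 + a * x ≠ 0 := by have := hu x hx; linarith
    have h := (h1 x hx).fun_mul ((hasDerivAt_const x (c * a)).fun_div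
      ((hdu x).fun_mul ((hdL x hx).fun_pow 2)) (mul_ne_zero hux (pow_ne_zero 2 hLx)))
    have he : deriv φ =ᶠ[nhds x]
        fun y => φ y * (c * a / ((1 + a * y) * Real.log (1 + a * y) ^ 2)) := by
      filter_upwards [lt_mem_nhds hx] with y hy
      exact (h1 y hy).deriv
    refine (h.congr_of_eventuallyEq he).congr_deriv ?_
    generalize Real.log (1 + a * x) = L at *
    generalize 1 + a * x = u at *
    field_simp
    norm_num
    ring
  refine ⟨fun x hx => ⟨(h1 x hx).differentiableAt, (h2 x hx).differentiableAt⟩, ?_⟩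
  intro x hx
  have hLx := hL x hx
  have hux : 0 < 1 + a * x := by have := hu x hx; linarith
  have hφx : 0 < φ x := by rw [hφ]; exact Real.exp_pos _
  have hK : 0 < φ x * (c * a ^ 2 / ((1 + a * x) ^ 2 * Real.log (1 + a * x) ^ 4)) := by
    positivity
  rw [(h2 x hx).deriv, sub_lt_iff_lt_add, Real.sqrt_lt' (by linarith), mul_neg_iff]
  constructor
  · rintro (⟨_, h⟩ | ⟨h, _⟩) <;> linarith
  · intro h
    exact Or.inl ⟨hK, by linarith⟩
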